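/- arXiv:math/0311336 — 2 statements merged into one kernel-verified Lean document; each statement's English description precedes it below -/
import Mathlib

section
/- Let p be a real number with 1 ≤ p < ∞ and p ≠ 2, and let a, b ∈ ℂ. Then |a + b|^p + |a − b|^p = 2(|a|^p + |b|^p) if and only if a·b = 0. Moreover, for 1 ≤ p < 2 one always has |a + b|^p + |a − b|^p ≤ 2(|a|^p + |b|^p), while for p > 2 one always has |a + b|^p + |a − b|^p ≥ 2(|a|^p + |b|^p). -/
lemma rpow_split {x q : ℝ} (hx : 0 < x) : x ^ q = x * x ^ (q - 1) := by
  rw [Real.rpow_sub_one hx.ne']; field_simp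

lemma superadd {x y q : ℝ} (hx : 0 < x) (hy : 0 < y) (hq : 1 < q) :
    x ^ q + y ^ q < (x + y) ^ q := by
  rw [rpow_split hx, rpow_split hy, rpow_split (add_pos hx hy)]
  have h1 : x ^ (q - 1) < (x + y) ^ (q - 1) :=
    Real.rpow_lt_rpow hx.le (by linarith) (by linarith)
  have h2 : y ^ (q - 1) < (x + y) ^ (q - 1) :=
    Real.rpow_lt_rpow hy.le (by linarith) (by linarith)
  have := mul_lt_mul_of_pos_left h1 hx
  have := mul_lt_mul_of_pos_left h2 hy
  linarith

lemma subadd {x y q : ℝ} (hx : 0 < x) (hy : 0 < y) (hq : q < 1) :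
    (x + y) ^ q < x ^ q + y ^ q := by
  rw [rpow_split hx, rpow_split hy, rpow_split (add_pos hx hy)]
  have h1 : (x + y) ^ (q - 1) < x ^ (q - 1) :=
    Real.rpow_lt_rpow_of_neg hx (by linarith) (by linarith)
  have h2 : (x + y) ^ (q - 1) < y ^ (q - 1) :=
    Real.rpow_lt_rpow_of_neg hy (by linarith) (by linarith)
  have := mul_lt_mul_of_pos_left h1 hx
  have := mul_lt_mul_of_pos_left h2 hy
  linarith

lemma norm_rpow_eq (z : ℂ) (p : ℝ) : ‖z‖ ^ p = (‖z‖ ^ 2) ^ (p / 2) := by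
  rw [← Real.rpow_natCast, ← Real.rpow_mul (norm_nonneg z)]
  congr 1; push_cast; ring

lemma clarkson_lt {p : ℝ} (hp1 : 1 ≤ p) (hp : p < 2) {a b : ℂ} (ha : a ≠ 0) (hb : b ≠ 0) :
    ‖a + b‖ ^ p + ‖a - b‖ ^ p < 2 * (‖a‖ ^ p + ‖b‖ ^ p) := by
  have par := parallelogram_law_with_norm ℝ a b
  simp only [norm_rpow_eq _ p]
  have h1 := subadd (x := ‖a‖ ^ 2) (y := ‖b‖ ^ 2) (q := p / 2)
    (by positivity) (by positivity) (by linarith)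
  have h2 := (Real.concaveOn_rpow (p := p / 2) (by linarith) (by linarith)).2
    (show ‖a + b‖ ^ 2 ∈ Set.Ici (0 : ℝ) from Set.mem_Ici.2 (by positivity))
    (show ‖a - b‖ ^ 2 ∈ Set.Ici (0 : ℝ) from Set.mem_Ici.2 (by positivity))
    (show (0 : ℝ) ≤ 1 / 2 by norm_num) (show (0 : ℝ) ≤ 1 / 2 by norm_num) (by norm_num)
  simp only [smul_eq_mul] at h2
  rw [show 1 / 2 * ‖a + b‖ ^ 2 + 1 / 2 * ‖a - b‖ ^ 2 = ‖a‖ ^ 2 + ‖b‖ ^ 2 by linarith] at h2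
  linarith

lemma clarkson_gt {p : ℝ} (hp : 2 < p) {a b : ℂ} (ha : a ≠ 0) (hb : b ≠ 0) :
    2 * (‖a‖ ^ p + ‖b‖ ^ p) < ‖a + b‖ ^ p + ‖a - b‖ ^ p := by
  have par := parallelogram_law_with_norm ℝ a b
  simp only [norm_rpow_eq _ p]
  have h1 := superadd (x := ‖a‖ ^ 2) (y := ‖b‖ ^ 2) (q := p / 2)
    (by positivity) (by positivity) (by linarith)
  have h2 := (convexOn_rpow (p := p / 2) (by linarith)).2
    (show ‖a + b‖ ^ 2 ∈ Set.Ici (0 : ℝ) from Set.mem_Ici.2 (by positivity))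
    (show ‖a - b‖ ^ 2 ∈ Set.Ici (0 : ℝ) from Set.mem_Ici.2 (by positivity))
    (show (0 : ℝ) ≤ 1 / 2 by norm_num) (show (0 : ℝ) ≤ 1 / 2 by norm_num) (by norm_num)
  simp only [smul_eq_mul] at h2
  rw [show 1 / 2 * ‖a + b‖ ^ 2 + 1 / 2 * ‖a - b‖ ^ 2 = ‖a‖ ^ 2 + ‖b‖ ^ 2 by linarith] at h2
  linarith

lemma clarkson_eq {p : ℝ} (hp1 : 1 ≤ p) {a b : ℂ} (h : a * b = 0) :
    ‖a + b‖ ^ p + ‖a - b‖ ^ p = 2 * (‖a‖ ^ p + ‖b‖ ^ p) := by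
  have h0 : (0 : ℝ) ^ p = 0 := Real.zero_rpow (by linarith)
  rcases mul_eq_zero.1 h with rfl | rfl
  · simp [h0]; ring
  · simp [h0]; ring

/-- Scalar Clarkson inequality with its equality condition: for `1 ≤ p < ∞`, `p ≠ 2`,
and `a, b ∈ ℂ`, equality `|a+b|^p + |a−b|^p = 2(|a|^p + |b|^p)` holds iff `a·b = 0`;
moreover `≤` always holds when `1 ≤ p < 2` and `≥` always holds when `p > 2`. -/
theorem stmt3 (p : ℝ) (hp1 : 1 ≤ p) (hp2 : p ≠ 2) (a b : ℂ) :
    (‖a + b‖ ^ p + ‖a - b‖ ^ p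
        = 2 * (‖a‖ ^ p + ‖b‖ ^ p) ↔ a * b = 0) ∧
    (p < 2 → ‖a + b‖ ^ p + ‖a - b‖ ^ p
        ≤ 2 * (‖a‖ ^ p + ‖b‖ ^ p)) ∧
    (2 < p → 2 * (‖a‖ ^ p + ‖b‖ ^ p)
        ≤ ‖a + b‖ ^ p + ‖a - b‖ ^ p) := by
  by_cases h : a * b = 0
  · have e := clarkson_eq hp1 h
    exact ⟨⟨fun _ => h, fun _ => e⟩, fun _ => e.le, fun _ => e.ge⟩
  · obtain ⟨ha, hb⟩ := mul_ne_zero_iff.1 h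
    refine ⟨⟨fun e => ?_, fun h' => absurd h' h⟩, fun hp => (clarkson_lt hp1 hp ha hb).le,
      fun hp => (clarkson_gt hp ha hb).le⟩
    rcases lt_or_gt_of_ne hp2 with hp | hp
    · exact absurd e (clarkson_lt hp1 hp ha hb).ne
    · exact absurd e (clarkson_gt hp ha hb).ne'
end

section
/- Let n ≥ 1, let 0 < p < ∞ with p ≠ 2, and for X ∈ M_n(ℂ) set S_p(X) = Σ_i s_i(X)^p, where s_1(X), …, s_n(X) are the singular values of X (the eigenvalues of the positive semidefinite square root of XᴴX). Then for A, B ∈ M_n(ℂ): S_p(A + B) + S_p(A − B) = 2(S_p(A) + S_p(B)) if and only if A·Bᴴ = 0 and Aᴴ·B = 0. -/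
open Matrix
open scoped ComplexOrder MatrixOrder

/-- The singular values of a complex square matrix: the eigenvalues of the positive
semidefinite square root of `XᴴX`. -/
noncomputable def singularValues {n : ℕ} (X : Matrix (Fin n) (Fin n) ℂ) : Fin n → ℝ :=
  (CFC.sqrt_nonneg (Xᴴ * X)).posSemidef.1.eigenvalues

/-- `S_p(X) = Σ_i s_i(X)^p`, the `p`-th power of the Schatten `p`-norm. -/
noncomputable def schattenPowSum {n : ℕ} (p : ℝ) (X : Matrix (Fin n) (Fin n) ℂ) : ℝ :=
  ∑ i, singularValues X i ^ p

/-- Trace functional `Tr f(G)` defined through the roots of the characteristic polynomial. -/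
noncomputable def trFun {m : Type*} [Fintype m] [DecidableEq m] (f : ℝ → ℝ)
    (G : Matrix m m ℂ) : ℝ :=
  (G.charpoly.roots.map (fun z : ℂ => f z.re)).sum

section aux

variable {m k : Type*} [Fintype m] [DecidableEq m] [Fintype k] [DecidableEq k]

lemma trFun_X_pow (f : ℝ → ℝ) (hf0 : f 0 = 0) (j : ℕ) (M : Matrix m m ℂ) :
    (((Polynomial.X ^ j * M.charpoly : Polynomial ℂ)).roots.map (fun z : ℂ => f z.re)).sum
      = trFun f M := by
  rw [Polynomial.roots_mul (mul_ne_zero (pow_ne_zero _ Polynomial.X_ne_zero)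
    M.charpoly_monic.ne_zero)]
  simp [trFun, hf0, Multiset.map_nsmul, Multiset.sum_nsmul]

lemma trFun_mul_comm (f : ℝ → ℝ) (hf0 : f 0 = 0) (A : Matrix m k ℂ) (B : Matrix k m ℂ) :
    trFun f (A * B) = trFun f (B * A) := by
  rw [← trFun_X_pow f hf0 (Fintype.card k) (A * B), Matrix.charpoly_mul_comm' A B,
    trFun_X_pow f hf0]

lemma trFun_conj (f : ℝ → ℝ) (U G : Matrix m m ℂ) (hU : Uᴴ * U = 1) :
    trFun f (U * G * Uᴴ) = trFun f G := by
  unfold trFun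
  rw [Matrix.charpoly_mul_comm, ← mul_assoc, hU, one_mul]

lemma trFun_diagonal (f : ℝ → ℝ) (d : m → ℝ) :
    trFun f (diagonal (fun i => (d i : ℂ))) = ∑ i, f (d i) := by
  unfold trFun
  rw [Matrix.charpoly_diagonal, Polynomial.roots_prod _ _
    (by simp [Finset.prod_ne_zero_iff, Polynomial.X_sub_C_ne_zero])]
  simp

lemma trFun_blocks (f : ℝ → ℝ) (G : Matrix m m ℂ) (H : Matrix k k ℂ) :
    trFun f (fromBlocks G 0 0 H) = trFun f G + trFun f H := by
  unfold trFun
  rw [Matrix.charpoly_fromBlocks_zero₁₂, Polynomial.roots_mul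
    (mul_ne_zero G.charpoly_monic.ne_zero H.charpoly_monic.ne_zero)]
  simp

lemma herm_diag (G : Matrix m m ℂ) (hG : G.IsHermitian) :
    ∃ U : Matrix m m ℂ, Uᴴ * U = 1 ∧ U * Uᴴ = 1 ∧
      G = U * diagonal (fun i => (hG.eigenvalues i : ℂ)) * Uᴴ := by
  refine ⟨hG.eigenvectorUnitary, ?_, ?_, ?_⟩
  · exact Unitary.coe_star_mul_self hG.eigenvectorUnitary
  · exact Unitary.coe_mul_star_self hG.eigenvectorUnitary
  · conv_lhs => rw [hG.spectral_theorem]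
    rw [Unitary.conjStarAlgAut_apply]
    rfl

lemma psd_diag (G : Matrix m m ℂ) (hG : G.PosSemidef) :
    ∃ (U : Matrix m m ℂ) (μ : m → ℝ), Uᴴ * U = 1 ∧ U * Uᴴ = 1 ∧ (∀ i, 0 ≤ μ i) ∧
      G = U * diagonal (fun i => (μ i : ℂ)) * Uᴴ := by
  obtain ⟨U, h1, h2, h3⟩ := herm_diag G hG.1
  exact ⟨U, _, h1, h2, hG.eigenvalues_nonneg, h3⟩

/-- Schur / Peierls inequality with equality case. -/
lemma schur_ineq (f : ℝ → ℝ) (hf : StrictConvexOn ℝ (Set.Ici 0) f)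
    (G : Matrix m m ℂ) (hG : G.PosSemidef) :
    ∑ i, f (G i i).re ≤ trFun f G ∧
      (∑ i, f (G i i).re = trFun f G → ∀ i j, i ≠ j → G i j = 0) := by
  obtain ⟨U, μ, h1, h2, hμ, hG'⟩ := psd_diag G hG
  have hGd : ∀ i, (G i i).re = ∑ j, Complex.normSq (U i j) • μ j := by
    intro i
    rw [hG', Matrix.mul_apply]
    simp only [Matrix.mul_diagonal, Matrix.conjTranspose_apply, Complex.re_sum, smul_eq_mul]
    refine Finset.sum_congr rfl fun j _ => ?_
    simp [Complex.normSq_apply]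
    ring
  have hrow : ∀ i, ∑ j, Complex.normSq (U i j) = 1 := by
    intro i
    have := congrArg Complex.re (congrFun (congrFun h2 i) i)
    rw [Matrix.mul_apply] at this
    simp only [Matrix.conjTranspose_apply, Complex.re_sum, Matrix.one_apply_eq,
      Complex.one_re] at this
    rw [← this]
    refine Finset.sum_congr rfl fun j _ => ?_
    simp [Complex.normSq_apply]
  have hcol : ∀ j, ∑ i, Complex.normSq (U i j) = 1 := by
    intro i
    have := congrArg Complex.re (congrFun (congrFun h1 i) i)
    rw [Matrix.mul_apply] at this
    simp only [Matrix.conjTranspose_apply, Complex.re_sum, Matrix.one_apply_eq,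
      Complex.one_re] at this
    rw [← this]
    refine Finset.sum_congr rfl fun j _ => ?_
    simp [Complex.normSq_apply]
  have htr : trFun f G = ∑ i, ∑ j, Complex.normSq (U i j) • f (μ j) := by
    rw [hG', trFun_conj f U _ h1, trFun_diagonal, Finset.sum_comm]
    refine Finset.sum_congr rfl fun j _ => ?_
    rw [← Finset.sum_smul, hcol, one_smul]
  have hle : ∀ i ∈ Finset.univ, f (G i i).re ≤ ∑ j, Complex.normSq (U i j) • f (μ j) := by
    intro i _
    rw [hGd]
    exact hf.convexOn.map_sum_le (fun j _ => Complex.normSq_nonneg _) (hrow i)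
      (fun j _ => hμ j)
  refine ⟨htr ▸ Finset.sum_le_sum hle, fun heq => ?_⟩
  rw [htr, Finset.sum_eq_sum_iff_of_le hle] at heq
  have hGU : G * U = diagonal (fun i => ((G i i).re : ℂ)) * U := by
    have : G * U = U * diagonal (fun i => (μ i : ℂ)) := by
      conv_lhs => rw [hG']
      rw [mul_assoc, h1, mul_one]
    rw [this]
    ext i j
    rw [Matrix.mul_diagonal, Matrix.diagonal_mul, mul_comm]
    by_cases hU : U i j = 0
    · simp [hU]
    have he := heq i (Finset.mem_univ i)
    rw [hGd i] at he
    have he' := (hf.map_sum_eq_iff_of_nonneg (fun j _ => Complex.normSq_nonneg _) (hrow i)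
      (fun j _ => hμ j)).1 he
    have : (G i i).re = μ j := by
      rw [hGd i]
      have : ∀ l ∈ Finset.univ, Complex.normSq (U i l) • μ l = Complex.normSq (U i l) • μ j := by
        intro l _
        by_cases hl : Complex.normSq (U i l) = 0
        · simp [hl]
        · rw [he' (Finset.mem_univ l) hl (Finset.mem_univ j) (by simpa using hU)]
      rw [Finset.sum_congr rfl this, ← Finset.sum_smul, hrow, one_smul]
    rw [this]
  have hGD : G = diagonal (fun i => ((G i i).re : ℂ)) := by
    have := congrArg (· * Uᴴ) hGU
    simpa only [mul_assoc, h2, mul_one] using this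
  intro i j hij
  rw [hGD, Matrix.diagonal_apply_ne _ hij]

lemma trFun_conv (f : ℝ → ℝ) (hf : StrictConvexOn ℝ (Set.Ici 0) f)
    (M N G : Matrix m m ℂ) (hM : M.PosSemidef) (hN : N.PosSemidef) (hMN : M + N = G + G) :
    2 * trFun f G ≤ trFun f M + trFun f N := by
  have hG : G.IsHermitian := by
    have h := (hM.add hN).1
    rw [hMN] at h
    ext i j
    have := congrFun (congrFun h i) j
    simp only [Matrix.conjTranspose_apply, Matrix.add_apply, star_add] at this ⊢
    linear_combination this / 2
  obtain ⟨U, h1, h2, hG'⟩ := herm_diag G hG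
  have hc : ∀ X : Matrix m m ℂ, trFun f (Uᴴ * X * U) = trFun f X := by
    intro X
    have := trFun_conj f Uᴴ X (by simpa using h2)
    simpa using this
  have hM' : (Uᴴ * M * U).PosSemidef := hM.conjTranspose_mul_mul_same U
  have hN' : (Uᴴ * N * U).PosSemidef := hN.conjTranspose_mul_mul_same U
  have a1 := (schur_ineq f hf _ hM').1
  have a2 := (schur_ineq f hf _ hN').1
  rw [hc] at a1 a2
  have hD : Uᴴ * M * U + Uᴴ * N * U
      = diagonal (fun i => (hG.eigenvalues i : ℂ)) + diagonal (fun i => (hG.eigenvalues i : ℂ)) := by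
    have hUGU : Uᴴ * G * U = diagonal (fun i => (hG.eigenvalues i : ℂ)) := by
      conv_lhs => rw [hG']
      rw [show Uᴴ * (U * diagonal (fun i => (hG.eigenvalues i : ℂ)) * Uᴴ) * U
        = (Uᴴ * U) * diagonal (fun i => (hG.eigenvalues i : ℂ)) * (Uᴴ * U) by
          simp only [mul_assoc], h1, one_mul, mul_one]
    rw [← Matrix.add_mul, ← Matrix.mul_add, hMN, Matrix.mul_add, Matrix.add_mul, hUGU]
  have htr : trFun f G = ∑ i, f (hG.eigenvalues i) := by
    conv_lhs => rw [hG']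
    rw [trFun_conj f U _ h1, trFun_diagonal]
  have key : ∀ i, 2 * f (hG.eigenvalues i) ≤
      f ((Uᴴ * M * U) i i).re + f ((Uᴴ * N * U) i i).re := by
    intro i
    have e := congrArg Complex.re (congrFun (congrFun hD i) i)
    simp only [Matrix.add_apply, Matrix.diagonal_apply_eq, Complex.add_re,
      Complex.ofReal_re] at e
    have p1 : 0 ≤ ((Uᴴ * M * U) i i).re := (Complex.le_def.1 hM'.diag_nonneg).1
    have p2 : 0 ≤ ((Uᴴ * N * U) i i).re := (Complex.le_def.1 hN'.diag_nonneg).1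
    have c := hf.convexOn.2 (Set.mem_Ici.2 p1) (Set.mem_Ici.2 p2)
      (by norm_num : (0 : ℝ) ≤ 1/2) (by norm_num : (0 : ℝ) ≤ 1/2) (by norm_num)
    simp only [smul_eq_mul] at c
    rw [show 1/2 * ((Uᴴ * M * U) i i).re + 1/2 * ((Uᴴ * N * U) i i).re
      = hG.eigenvalues i by linarith] at c
    linarith
  rw [htr, Finset.mul_sum]
  calc _ ≤ ∑ i, (f ((Uᴴ * M * U) i i).re + f ((Uᴴ * N * U) i i).re) :=
        Finset.sum_le_sum fun i _ => key i
    _ ≤ _ := by rw [Finset.sum_add_distrib]; linarith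

lemma rows_gram (A B : Matrix m m ℂ) :
    (fromRows A B)ᴴ * fromRows A B = Aᴴ * A + Bᴴ * B := by
  rw [conjTranspose_fromRows_eq_fromCols_conjTranspose, fromCols_mul_fromRows]

lemma rows_gram' (A B : Matrix m m ℂ) :
    fromRows A B * (fromRows A B)ᴴ = fromBlocks (A * Aᴴ) (A * Bᴴ) (B * Aᴴ) (B * Bᴴ) := by
  rw [conjTranspose_fromRows_eq_fromCols_conjTranspose, fromRows_mul_fromCols]

lemma trFun_super (f : ℝ → ℝ) (hf : StrictConvexOn ℝ (Set.Ici 0) f) (hf0 : f 0 = 0)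
    (A B : Matrix m m ℂ) :
    trFun f (Aᴴ * A) + trFun f (Bᴴ * B) ≤ trFun f (Aᴴ * A + Bᴴ * B) ∧
    (trFun f (Aᴴ * A) + trFun f (Bᴴ * B) = trFun f (Aᴴ * A + Bᴴ * B) → A * Bᴴ = 0) := by
  obtain ⟨U, μ, u1, u2, -, hA⟩ := psd_diag _ (posSemidef_self_mul_conjTranspose A)
  obtain ⟨V, ν, v1, v2, -, hB⟩ := psd_diag _ (posSemidef_self_mul_conjTranspose B)
  have hdiag : ∀ (W X D : Matrix m m ℂ), Wᴴ * W = 1 → X * Xᴴ = W * D * Wᴴ →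
      (Wᴴ * X) * (Wᴴ * X)ᴴ = D := by
    intro W X D hW hX
    rw [Matrix.conjTranspose_mul, Matrix.conjTranspose_conjTranspose,
      show Wᴴ * X * (Xᴴ * W) = Wᴴ * (X * Xᴴ) * W by simp only [mul_assoc], hX,
      show Wᴴ * (W * D * Wᴴ) * W = (Wᴴ * W) * D * (Wᴴ * W) by simp only [mul_assoc],
      hW, one_mul, mul_one]
  have hgram : ∀ (W X : Matrix m m ℂ), W * Wᴴ = 1 → (Wᴴ * X)ᴴ * (Wᴴ * X) = Xᴴ * X := by
    intro W X hW
    rw [Matrix.conjTranspose_mul, Matrix.conjTranspose_conjTranspose,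
      show Xᴴ * W * (Wᴴ * X) = Xᴴ * (W * Wᴴ) * X by simp only [mul_assoc], hW, mul_one]
  have hC : trFun f (Aᴴ * A + Bᴴ * B) =
      trFun f (fromRows (Uᴴ * A) (Vᴴ * B) * (fromRows (Uᴴ * A) (Vᴴ * B))ᴴ) := by
    rw [trFun_mul_comm f hf0, rows_gram, hgram U A u2, hgram V B v2]
  have hS := schur_ineq f hf _ (posSemidef_self_mul_conjTranspose (fromRows (Uᴴ * A) (Vᴴ * B)))
  rw [← hC, rows_gram', hdiag U A _ u1 hA, hdiag V B _ v1 hB] at hS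
  have hsum : trFun f (Aᴴ * A) + trFun f (Bᴴ * B) = ∑ i, f (μ i) + ∑ i, f (ν i) := by
    rw [trFun_mul_comm f hf0 Aᴴ, trFun_mul_comm f hf0 Bᴴ, hA, hB, trFun_conj f U _ u1,
      trFun_conj f V _ v1, trFun_diagonal, trFun_diagonal]
  simp only [Fintype.sum_sum_type, fromBlocks_apply₁₁, fromBlocks_apply₂₂,
    Matrix.diagonal_apply_eq, Complex.ofReal_re] at hS
  rw [← hsum] at hS
  refine ⟨hS.1, fun h => ?_⟩
  have h0 : Uᴴ * A * (Vᴴ * B)ᴴ = 0 := by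
    ext i j
    have := hS.2 h (Sum.inl i) (Sum.inr j) (by simp)
    simpa only [fromBlocks_apply₁₂, Matrix.zero_apply] using this
  calc A * Bᴴ = (U * Uᴴ) * A * (Bᴴ * (V * Vᴴ)) := by rw [u2, v2, one_mul, mul_one]
    _ = U * (Uᴴ * A * (Vᴴ * B)ᴴ) * Vᴴ := by
        rw [Matrix.conjTranspose_mul, Matrix.conjTranspose_conjTranspose]
        simp only [mul_assoc]
    _ = 0 := by rw [h0, mul_zero, zero_mul]

lemma par (A B : Matrix m m ℂ) :
    (A + B)ᴴ * (A + B) + (A - B)ᴴ * (A - B) = (Aᴴ * A + Bᴴ * B) + (Aᴴ * A + Bᴴ * B) := by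
  rw [Matrix.conjTranspose_add, Matrix.conjTranspose_sub]
  noncomm_ring

lemma main_half (f : ℝ → ℝ) (hf : StrictConvexOn ℝ (Set.Ici 0) f) (hf0 : f 0 = 0)
    (A B : Matrix m m ℂ)
    (h : trFun f ((A + B)ᴴ * (A + B)) + trFun f ((A - B)ᴴ * (A - B))
      = 2 * (trFun f (Aᴴ * A) + trFun f (Bᴴ * B))) : A * Bᴴ = 0 := by
  have a := trFun_conv f hf _ _ _ (posSemidef_conjTranspose_mul_self (A + B))
    (posSemidef_conjTranspose_mul_self (A - B)) (par A B)
  have b := trFun_super f hf hf0 A B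
  exact b.2 (by linarith [b.1])

lemma main_full (f : ℝ → ℝ) (hf : StrictConvexOn ℝ (Set.Ici 0) f) (hf0 : f 0 = 0)
    (A B : Matrix m m ℂ) :
    trFun f ((A + B)ᴴ * (A + B)) + trFun f ((A - B)ᴴ * (A - B))
      = 2 * (trFun f (Aᴴ * A) + trFun f (Bᴴ * B)) ↔ A * Bᴴ = 0 ∧ Aᴴ * B = 0 := by
  constructor
  · intro h
    refine ⟨main_half f hf hf0 A B h, ?_⟩
    have := main_half f hf hf0 Aᴴ Bᴴ (by
      rw [← Matrix.conjTranspose_add, ← Matrix.conjTranspose_sub]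
      simp only [Matrix.conjTranspose_conjTranspose]
      rw [trFun_mul_comm f hf0 (A + B), trFun_mul_comm f hf0 (A - B), trFun_mul_comm f hf0 A,
        trFun_mul_comm f hf0 B]
      exact h)
    simpa using this
  · rintro ⟨h1, h2⟩
    have h2' : Bᴴ * A = 0 := by
      have := congrArg Matrix.conjTranspose h2
      simpa using this
    have h1' : B * Aᴴ = 0 := by
      have := congrArg Matrix.conjTranspose h1
      simpa using this
    have e1 : (A + B)ᴴ * (A + B) = Aᴴ * A + Bᴴ * B := by
      rw [Matrix.conjTranspose_add, Matrix.add_mul, Matrix.mul_add, Matrix.mul_add, h2, h2']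
      simp
    have e2 : (A - B)ᴴ * (A - B) = Aᴴ * A + Bᴴ * B := by
      rw [Matrix.conjTranspose_sub, Matrix.sub_mul, Matrix.mul_sub, Matrix.mul_sub, h2, h2']
      simp
    have e3 : trFun f (Aᴴ * A + Bᴴ * B) = trFun f (Aᴴ * A) + trFun f (Bᴴ * B) := by
      rw [← rows_gram, trFun_mul_comm f hf0, rows_gram', h1, h1', trFun_blocks,
        trFun_mul_comm f hf0 A, trFun_mul_comm f hf0 B]
    rw [e1, e2, e3]
    ring

end aux

lemma schatten_eq {n : ℕ} (p : ℝ) (X : Matrix (Fin n) (Fin n) ℂ) :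
    schattenPowSum p X = trFun (fun t => t ^ (p / 2)) (Xᴴ * X) := by
  have hS := (CFC.sqrt_nonneg (Xᴴ * X)).posSemidef
  obtain ⟨U, h1, h2, h3⟩ := herm_diag _ hS.1
  have h0 : ∀ i, 0 ≤ hS.1.eigenvalues i := hS.eigenvalues_nonneg
  have hs : singularValues X = hS.1.eigenvalues := rfl
  generalize hS.1.eigenvalues = s at h3 h0 hs
  have hsq : CFC.sqrt (Xᴴ * X) * CFC.sqrt (Xᴴ * X) = Xᴴ * X :=
    CFC.sqrt_mul_sqrt_self _ (posSemidef_conjTranspose_mul_self X).nonneg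
  have hX : Xᴴ * X = U * diagonal (fun i => ((s i ^ 2 : ℝ) : ℂ)) * Uᴴ := by
    rw [← hsq, h3, show ∀ D : Matrix (Fin n) (Fin n) ℂ, U * D * Uᴴ * (U * D * Uᴴ)
      = U * D * (Uᴴ * U) * D * Uᴴ from fun D => by simp only [mul_assoc], h1, mul_one,
      mul_assoc U, Matrix.diagonal_mul_diagonal]
    simp [pow_two]
  rw [hX, trFun_conj _ U _ h1, trFun_diagonal]
  unfold schattenPowSum
  rw [hs]
  refine Finset.sum_congr rfl fun i _ => ?_
  rw [← Real.rpow_natCast, ← Real.rpow_mul (h0 i)]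
  congr 1
  push_cast
  ring

lemma trFun_neg {n : ℕ} (f : ℝ → ℝ) (X : Matrix (Fin n) (Fin n) ℂ) :
    trFun (fun t => - f t) X = - trFun f X := by
  simp [trFun]

/-- Equality condition in the noncommutative Clarkson inequality for matrices:
`S_p(A+B) + S_p(A−B) = 2(S_p(A) + S_p(B))` iff `ABᴴ = 0` and `AᴴB = 0`. -/
theorem stmt4 {n : ℕ} (hn : 1 ≤ n) (p : ℝ) (hp0 : 0 < p) (hp2 : p ≠ 2)
    (A B : Matrix (Fin n) (Fin n) ℂ) :
    schattenPowSum p (A + B) + schattenPowSum p (A - B)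
        = 2 * (schattenPowSum p A + schattenPowSum p B)
      ↔ A * Bᴴ = 0 ∧ Aᴴ * B = 0 := by
  simp only [schatten_eq]
  rcases lt_or_gt_of_ne hp2 with h | h
  · have hf : StrictConvexOn ℝ (Set.Ici 0) (fun t : ℝ => - t ^ (p / 2)) :=
      (Real.strictConcaveOn_rpow (by linarith) (by linarith)).neg
    rw [← main_full _ hf (by simp [Real.zero_rpow (by linarith : p / 2 ≠ 0)]) A B]
    simp only [trFun_neg]
    constructor <;> intro h <;> linarith
  · exact main_full _ (strictConvexOn_rpow (by linarith))
      (by simp [Real.zero_rpow (by linarith : p / 2 ≠ 0)]) A B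
end
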